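/- arXiv:2006.02265 — 2 statements merged into one kernel-verified Lean document; each statement's English description precedes it below -/
import Mathlib

section
/- Let G be a finite non-abelian group and let t be a non-central element of G such that t^2 is central. Then |G| ≤ (1 + i(Z))·|C_G(t)| + (k(G) − |Z|)·|C_G(t)|^2, where Z = Z(G), i(Z) is the number of involutions in Z, and k(G) is the number of conjugacy classes of G. -/
/-- Orbit-stabilizer for the conjugation action. -/
theorem card_conjugatesOf_mul_card_centralizer {G : Type*} [Group G] (t : G) :
    Nat.card (conjugatesOf t) * Nat.card (Subgroup.centralizer ({t} : Set G)) = Nat.card G := by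
  rw [Subgroup.nat_card_centralizer_nat_card_stabilizer, ← Nat.card_prod]
  have h : conjugatesOf t = MulAction.orbit (ConjAct G) t := by
    ext x
    rw [ConjAct.mem_orbit_conjAct, isConj_comm]
    rfl
  rw [h]
  exact Nat.card_congr (MulAction.orbitProdStabilizerEquivGroup (ConjAct G) t)

/-- The centralizer orders of the elements of a finite group sum to `k(G) * |G|`. -/
theorem sum_card_centralizer {G : Type*} [Group G] [Fintype G] :
    ∑ x : G, Nat.card (Subgroup.centralizer ({x} : Set G)) =
      Nat.card (ConjClasses G) * Nat.card G := by
  rw [← card_comm_eq_card_conjClasses_mul_card, ← Nat.card_sigma]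
  refine Nat.card_congr
    ⟨fun p => ⟨(p.1, p.2.1), ?_⟩, fun p => ⟨p.1.1, p.1.2, ?_⟩, fun _ => rfl, fun _ => rfl⟩
  · exact (Subgroup.mem_centralizer_singleton_iff.1 p.2.2).symm
  · exact Subgroup.mem_centralizer_singleton_iff.2 p.2.eq.symm

open Classical in
/-- The centralizer orders of the non-central elements sum to `(k(G) - |Z(G)|) * |G|`. -/
theorem sum_card_centralizer_noncentral {G : Type*} [Group G] [Fintype G] :
    ((∑ x : G with x ∉ Subgroup.center G, Nat.card (Subgroup.centralizer ({x} : Set G)) : ℕ) : ℤ) =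
      ((Nat.card (ConjClasses G) : ℤ) - Nat.card (Subgroup.center G)) * Nat.card G := by
  have hcentral : ∑ x : G with x ∈ Subgroup.center G,
      Nat.card (Subgroup.centralizer ({x} : Set G)) =
        Nat.card (Subgroup.center G) * Nat.card G := by
    rw [Finset.sum_congr rfl (g := fun _ => Nat.card G), Finset.sum_const, smul_eq_mul,
      Nat.card_eq_fintype_card (α := Subgroup.center G), Fintype.card_subtype]
    intro x hx
    have hx' : x ∈ Subgroup.center G := by simpa using hx
    rw [Subgroup.centralizer_eq_top_iff_subset.2 (by simpa using hx'), Subgroup.card_top]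
  have hsplit := Finset.sum_filter_add_sum_filter_not Finset.univ (· ∈ Subgroup.center G)
    (fun x : G => Nat.card (Subgroup.centralizer ({x} : Set G)))
  rw [sum_card_centralizer, hcentral] at hsplit
  have := congrArg (Nat.cast : ℕ → ℤ) hsplit
  rw [Nat.cast_add, Nat.cast_mul, Nat.cast_mul] at this
  linarith

/-- If `a` and `b` have the same square, then `a` inverts `a * b⁻¹`. -/
theorem conj_mul_inv_eq_inv {G : Type*} [Group G] {a b : G} (hab : a ^ 2 = b ^ 2) :
    a * (a * b⁻¹) * a⁻¹ = (a * b⁻¹)⁻¹ := by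
  have h : a * (a * b⁻¹) = b := by
    rw [← mul_assoc, ← pow_two, hab, pow_two, mul_inv_cancel_right]
  rw [h, mul_inv_rev, inv_inv]

/-- Conjugates of an element with central square have the same square. -/
theorem sq_eq_of_isConj {G : Type*} [Group G] {a t : G} (h : IsConj t a)
    (ht : t ^ 2 ∈ Subgroup.center G) : a ^ 2 = t ^ 2 := by
  obtain ⟨g, rfl⟩ := isConj_iff.1 h
  rw [conj_pow, Subgroup.mem_center_iff.1 ht g, mul_inv_cancel_right]

/-- The elements inverting `x` by conjugation number at most `|C_G(x)|`. -/
theorem card_inverting_le_card_centralizer {G : Type*} [Group G] [Finite G] (x : G) :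
    Nat.card {a : G | a * x * a⁻¹ = x⁻¹} ≤ Nat.card (Subgroup.centralizer ({x} : Set G)) := by
  rcases isEmpty_or_nonempty {a : G | a * x * a⁻¹ = x⁻¹} with h | ⟨⟨a₀, h₀⟩⟩
  · simp
  · refine Nat.card_le_card_of_injective (fun a => ⟨a₀⁻¹ * a.1, ?_⟩) ?_
    · have ha : a.1 * x * a.1⁻¹ = a₀ * x * a₀⁻¹ := a.2.trans h₀.symm
      rw [Subgroup.mem_centralizer_singleton_iff]
      have := mul_inv_eq_iff_eq_mul.1 ha
      rw [mul_assoc, this]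
      group
    · intro a b hab
      exact Subtype.ext (mul_left_cancel (congrArg Subtype.val hab))

open Classical in
/-- Brauer–Fowler count: sorting the pairs of conjugates of `t` by their quotient. -/
theorem card_conjugatesOf_sq_le {G : Type*} [Group G] [Fintype G] (t : G)
    (ht2 : t ^ 2 ∈ Subgroup.center G) :
    Nat.card (conjugatesOf t) ^ 2 ≤
      (1 + Nat.card {z : G | z ∈ Subgroup.center G ∧ z ^ 2 = 1 ∧ z ≠ 1}) *
          Nat.card (conjugatesOf t) +
        ∑ x : G with x ∉ Subgroup.center G, Nat.card (Subgroup.centralizer ({x} : Set G)) := by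
  set T : Finset G := {a | IsConj t a} with hT
  have hcard : Nat.card (conjugatesOf t) = T.card := by
    rw [hT, Nat.card_eq_fintype_card, ← Fintype.card_subtype]
    rfl
  have hinv : ∀ a ∈ T, ∀ b ∈ T, a * (a * b⁻¹) * a⁻¹ = (a * b⁻¹)⁻¹ := by
    intro a ha b hb
    have ha' := sq_eq_of_isConj (Finset.mem_filter.1 ha).2 ht2
    have hb' := sq_eq_of_isConj (Finset.mem_filter.1 hb).2 ht2
    exact conj_mul_inv_eq_inv (ha'.trans hb'.symm)
  let fib (x : G) : Finset (G × G) := {p ∈ T ×ˢ T | p.1 * p.2⁻¹ = x}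
  have hmem : ∀ {x : G} {p : G × G}, p ∈ fib x → p.1 ∈ T ∧ p.2 ∈ T ∧ p.1 * p.2⁻¹ = x := by
    intro x p hp
    simpa [fib, and_assoc] using hp
  have hinj : ∀ x : G, Set.InjOn Prod.fst (fib x : Set (G × G)) := by
    rintro x ⟨a, b⟩ hp ⟨a', b'⟩ hq (rfl : a = a')
    have h := (hmem hp).2.2.trans (hmem hq).2.2.symm
    simpa using h
  have hfibT : ∀ x, (fib x).card ≤ T.card := fun x =>
    Finset.card_le_card_of_injOn Prod.fst (fun p hp => (hmem hp).1) (hinj x)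
  have hfibC : ∀ x, (fib x).card ≤ Nat.card (Subgroup.centralizer ({x} : Set G)) := by
    intro x
    refine le_trans ?_ (card_inverting_le_card_centralizer x)
    rw [Nat.card_eq_fintype_card, ← Set.toFinset_card]
    refine Finset.card_le_card_of_injOn Prod.fst (fun p hp => ?_) (hinj x)
    obtain ⟨h₁, h₂, rfl⟩ := hmem hp
    simpa using hinv _ h₁ _ h₂
  have hfib0 : ∀ x ∈ Subgroup.center G, x ^ 2 ≠ 1 → (fib x).card = 0 := by
    intro x hx hx2
    rw [Finset.card_eq_zero, Finset.eq_empty_iff_forall_notMem]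
    intro p hp
    obtain ⟨h₁, h₂, h₃⟩ := hmem hp
    have h := hinv _ h₁ _ h₂
    rw [h₃, Subgroup.mem_center_iff.1 hx, mul_inv_cancel_right] at h
    exact hx2 (by rw [pow_two, mul_eq_one_iff_eq_inv]; exact h)
  have hsum : T.card ^ 2 = ∑ x, (fib x).card := by
    rw [pow_two, ← Finset.card_product]
    exact Finset.card_eq_sum_card_fiberwise fun _ _ => Finset.mem_coe.2 (Finset.mem_univ _)
  have hcentral : ∑ x : G with x ∈ Subgroup.center G, (fib x).card ≤
      (1 + Nat.card {z : G | z ∈ Subgroup.center G ∧ z ^ 2 = 1 ∧ z ≠ 1}) * T.card := by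
    set I : Finset G := {z | z ∈ Subgroup.center G ∧ z ^ 2 = 1 ∧ z ≠ 1} with hI
    have hIcard : Nat.card {z : G | z ∈ Subgroup.center G ∧ z ^ 2 = 1 ∧ z ≠ 1} = I.card := by
      rw [hI, Nat.card_eq_fintype_card, ← Fintype.card_subtype]
      exact Fintype.card_congr (Equiv.refl _)
    calc ∑ x : G with x ∈ Subgroup.center G, (fib x).card
        = ∑ x ∈ insert 1 I, (fib x).card := by
          symm
          refine Finset.sum_subset (fun x hx => ?_) (fun x hx hx' => hfib0 x ?_ ?_)
          · rcases Finset.mem_insert.1 hx with rfl | hx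
            · simp [one_mem]
            · simp_all
          · simpa using hx
          · intro h
            by_cases h1 : x = 1 <;> simp_all
      _ ≤ (insert 1 I).card * T.card := Finset.sum_le_card_nsmul _ _ _ fun x _ => hfibT x
      _ ≤ _ := by
          rw [hIcard, add_comm]
          exact Nat.mul_le_mul_right _ (Finset.card_insert_le _ _)
  rw [hcard, hsum, ← Finset.sum_filter_add_sum_filter_not Finset.univ (· ∈ Subgroup.center G)]
  exact add_le_add hcentral (Finset.sum_le_sum fun x _ => hfibC x)

/-- For a finite non-abelian group `G` and a non-central `t` with `t^2` central,
`|G| ≤ (1 + i(Z))·|C_G(t)| + (k(G) − |Z|)·|C_G(t)|^2`, where `Z = Z(G)`, `i(Z)` is the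
number of involutions in `Z`, and `k(G)` the number of conjugacy classes of `G`.
Stated over the integers. -/
theorem stmt_2 (G : Type*) [Group G] [Finite G]
    (hna : ∃ a b : G, a * b ≠ b * a)
    (t : G) (ht : t ∉ Subgroup.center G) (ht2 : t ^ 2 ∈ Subgroup.center G) :
    (Nat.card G : ℤ) ≤
      (1 + Nat.card {z : G | z ∈ Subgroup.center G ∧ z ^ 2 = 1 ∧ z ≠ 1}) *
          Nat.card (Subgroup.centralizer ({t} : Set G)) +
        ((Nat.card (ConjClasses G) : ℤ) - Nat.card (Subgroup.center G)) *
          (Nat.card (Subgroup.centralizer ({t} : Set G))) ^ 2 := by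
  have := Fintype.ofFinite G
  have hbound := card_conjugatesOf_sq_le t ht2
  have horb := card_conjugatesOf_mul_card_centralizer t
  zify at hbound horb
  rw [← Nat.cast_sum, sum_card_centralizer_noncentral, ← horb] at hbound
  have hpos : (0 : ℤ) < Nat.card (conjugatesOf t) := by
    have : Nonempty (conjugatesOf t) := ⟨⟨t, IsConj.refl t⟩⟩
    exact_mod_cast Nat.card_pos
  have hc : (0 : ℤ) ≤ Nat.card (Subgroup.centralizer ({t} : Set G)) := Nat.cast_nonneg _
  rw [← horb]
  generalize (Nat.card (conjugatesOf t) : ℤ) = m at *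
  generalize (Nat.card (Subgroup.centralizer ({t} : Set G)) : ℤ) = c at *
  have hquot : m ≤ 1 + Nat.card {z : G | z ∈ Subgroup.center G ∧ z ^ 2 = 1 ∧ z ≠ 1} +
      ((Nat.card (ConjClasses G) : ℤ) - Nat.card (Subgroup.center G)) * c :=
    le_of_mul_le_mul_right (by linarith) hpos
  calc m * c ≤ _ := mul_le_mul_of_nonneg_right hquot hc
    _ = _ := by ring
end

section
/- Let G be a finite non-abelian group such that the quotient G/Z(G) has even order. Then there exists a non-central element x of G such that |G| < |C_G(x)|^3. -/
open Finset in
/-- The commuting pairs in a finite group whose first component is non-central are counted by a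
multiple of the order of the group. -/
theorem card_dvd_sum_card_centralizer_noncentral (G : Type*) [Group G] [Fintype G]
    [DecidablePred (· ∈ Subgroup.center G)] :
    Nat.card G ∣ ∑ g : G with g ∉ Subgroup.center G,
      Nat.card (Subgroup.centralizer ({g} : Set G)) := by
  have hsum : ∑ g : G, Nat.card (Subgroup.centralizer ({g} : Set G)) =
      Nat.card (ConjClasses G) * Nat.card G := by
    rw [← card_comm_eq_card_conjClasses_mul_card, ← Nat.card_sigma]
    refine Nat.card_congr ⟨fun x => ⟨(x.1, x.2.1), ?_⟩, fun p => ⟨p.1.1, p.1.2, ?_⟩,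
      fun _ => rfl, fun _ => rfl⟩
    · exact (Subgroup.mem_centralizer_singleton_iff.mp x.2.2).symm
    · exact Subgroup.mem_centralizer_singleton_iff.mpr p.2.symm
  rw [← sum_filter_add_sum_filter_not univ (· ∈ Subgroup.center G)] at hsum
  refine (Nat.dvd_add_right (dvd_sum fun g hg => ?_)).mp (hsum ▸ dvd_mul_left _ _)
  rw [(Subgroup.centralizer_eq_top_iff_subset (s := {g})).mpr
    (Set.singleton_subset_iff.mpr (mem_filter.mp hg).2), Subgroup.card_top]

open Finset in
/-- The elements of a finite group inverting `g` are at most as many as those commuting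
with `g`. -/
theorem card_inverting_le_card_centralizer_s12 {G : Type*} [Group G] [Finite G] (g : G)
    (s : Finset G) (hs : ∀ v ∈ s, g * v * g = v) :
    #s ≤ Nat.card (Subgroup.centralizer ({g} : Set G)) := by
  obtain rfl | ⟨w, hw⟩ := s.eq_empty_or_nonempty
  · simp
  rw [← Fintype.card_coe s, ← Nat.card_eq_fintype_card]
  refine Nat.card_le_card_of_injective
    (fun v : s => (⟨w⁻¹ * v, Subgroup.mem_centralizer_singleton_iff.mpr ?_⟩ :
      Subgroup.centralizer ({g} : Set G))) fun a b hab => ?_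
  · have hv : (v : G) * g = g⁻¹ * v := by rw [eq_inv_mul_iff_mul_eq, ← mul_assoc, hs v v.2]
    have hw : w⁻¹ * g⁻¹ = g * w⁻¹ := by
      rw [← mul_inv_rev, inv_eq_iff_eq_inv, mul_inv_rev, inv_inv, eq_mul_inv_iff_mul_eq, hs w hw]
    rw [mul_assoc, hv, ← mul_assoc, hw, mul_assoc]
  · exact Subtype.ext (mul_left_cancel (congrArg Subtype.val hab))

/-- The number of conjugates of `t` times the order of its centralizer is the order of the
group. -/
theorem card_conjugates_mul_card_centralizer {G : Type*} [Group G] [Finite G] (t : G) :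
    Nat.card (conjugatesOf t) * Nat.card (Subgroup.centralizer ({t} : Set G)) = Nat.card G := by
  have h : conjugatesOf t = MulAction.orbit (ConjAct G) t := by
    ext x
    rw [ConjAct.mem_orbit_conjAct, isConj_comm]
    rfl
  rw [Subgroup.nat_card_centralizer_nat_card_stabilizer, h, ← Nat.card_prod]
  exact Nat.card_congr (MulAction.orbitProdStabilizerEquivGroup (ConjAct G) t)

open Finset in
/-- Counting the quotients of conjugates of an element whose square is central. -/
theorem sq_card_conjugates_le {G : Type*} [Group G] [Fintype G]
    [DecidablePred (· ∈ Subgroup.center G)] (t : G) (ht : t ^ 2 ∈ Subgroup.center G) :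
    Nat.card (conjugatesOf t) ^ 2 ≤
      Nat.card (Subgroup.center G) * Nat.card (conjugatesOf t) +
        ∑ g : G with g ∉ Subgroup.center G,
          Nat.card (Subgroup.centralizer ({g} : Set G)) := by
  classical
  obtain ⟨T, hT⟩ := (conjugatesOf t).toFinite.exists_finset_coe
  have hTcard : Nat.card (conjugatesOf t) = #T := by
    rw [← hT, Nat.card_coe_set_eq, Set.ncard_coe_finset]
  have hsq : ∀ u ∈ T, u * u = t * t := by
    intro u hu
    have hconj : u ∈ conjugatesOf t := hT ▸ mem_coe.mpr hu
    obtain ⟨c, rfl⟩ := isConj_iff.mp (show IsConj t u from hconj)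
    have := Subgroup.mem_center_iff.mp ht c
    rw [sq] at this
    calc c * t * c⁻¹ * (c * t * c⁻¹) = c * (t * t) * c⁻¹ := by group
      _ = t * t := by rw [this]; group
  have hfiber (g : G) : #{p ∈ T ×ˢ T | p.1 * p.2⁻¹ = g} ≤ #{v ∈ T | g * v * g = v} := by
    refine card_le_card_of_injOn Prod.snd ?_ ?_
    · rintro ⟨u, v⟩ h
      simp only [coe_filter, mem_product, Set.mem_ofPred_eq] at h ⊢
      obtain ⟨⟨hu, hv⟩, rfl⟩ := h
      refine ⟨hv, ?_⟩
      have := (hsq u hu).trans (hsq v hv).symm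
      simp [← mul_assoc, this]
    · rintro ⟨u, v⟩ h ⟨u', v'⟩ h' rfl
      simp only [coe_filter, mem_product, Set.mem_ofPred_eq] at h h'
      have := mul_right_cancel (h.2.trans h'.2.symm)
      simpa using this
  rw [hTcard, sq, ← card_product, card_eq_sum_card_fiberwise
    (f := fun p : G × G => p.1 * p.2⁻¹) (t := univ) (by simp [Set.MapsTo]),
    ← sum_filter_add_sum_filter_not univ (· ∈ Subgroup.center G)]
  refine add_le_add ?_ (sum_le_sum fun g _ => (hfiber g).trans
    (card_inverting_le_card_centralizer_s12 g _ fun v hv => (mem_filter.mp hv).2))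
  have hz : Nat.card (Subgroup.center G) = #{g : G | g ∈ Subgroup.center G} := by
    rw [Nat.card_eq_fintype_card, Fintype.card_subtype]
  rw [hz, ← smul_eq_mul]
  exact sum_le_card_nsmul _ _ _ fun g _ => (hfiber g).trans (card_filter_le _ _)

/-- If the central quotient has even order, some non-central element has central square. -/
theorem exists_noncentral_sq_mem_center {G : Type*} [Group G] [Finite G]
    (heven : Even (Nat.card (G ⧸ Subgroup.center G))) :
    ∃ t : G, t ∉ Subgroup.center G ∧ t ^ 2 ∈ Subgroup.center G := by
  have : Fact (Nat.Prime 2) := ⟨Nat.prime_two⟩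
  obtain ⟨x, hx⟩ := exists_prime_orderOf_dvd_card' (G := G ⧸ Subgroup.center G) 2 heven.two_dvd
  obtain ⟨t, rfl⟩ := QuotientGroup.mk_surjective x
  refine ⟨t, fun h => ?_, ?_⟩
  · rw [(QuotientGroup.eq_one_iff t).mpr h, orderOf_one] at hx
    omega
  · rw [← QuotientGroup.eq_one_iff, QuotientGroup.mk_pow, ← hx, pow_orderOf_eq_one]

/-- If `G` is a finite non-abelian group such that `G/Z(G)` has even order, then there is
a non-central `x ∈ G` with `|G| < |C_G(x)|^3`. -/
theorem stmt_12 (G : Type*) [Group G] [Finite G]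
    (hna : ∃ a b : G, a * b ≠ b * a)
    (heven : Even (Nat.card (G ⧸ Subgroup.center G))) :
    ∃ x : G, x ∉ Subgroup.center G ∧
      Nat.card G < (Nat.card (Subgroup.centralizer ({x} : Set G))) ^ 3 := by
  classical
  have := Fintype.ofFinite G
  obtain ⟨t, htZ, ht⟩ := exists_noncentral_sq_mem_center heven
  obtain ⟨x, hx, hmax⟩ := Finset.exists_max_image
    (Finset.univ.filter fun g : G => g ∉ Subgroup.center G)
    (fun g => Nat.card (Subgroup.centralizer ({g} : Set G))) ⟨t, by simpa using htZ⟩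
  refine ⟨x, (Finset.mem_filter.mp hx).2, ?_⟩
  have hcn := hmax t (by simpa using htZ)
  have hzc : Nat.card (Subgroup.center G) < Nat.card (Subgroup.centralizer ({t} : Set G)) := by
    refine Set.ncard_lt_ncard (Set.ssubset_iff_of_subset
      (Subgroup.center_le_centralizer _) |>.mpr ⟨t, ?_, htZ⟩)
    exact Subgroup.mem_centralizer_singleton_iff.mpr rfl
  have hclass := card_conjugates_mul_card_centralizer t
  have hcount := sq_card_conjugates_le t ht
  obtain ⟨m, hm⟩ := card_dvd_sum_card_centralizer_noncentral G
  have hsum := Finset.sum_le_card_nsmul _ _ _ hmax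
  rw [hm] at hcount hsum
  have hlt : (Finset.univ.filter fun g : G => g ∉ Subgroup.center G).card < Nat.card G := by
    rw [Nat.card_eq_fintype_card]
    exact Finset.card_lt_univ_of_notMem (x := 1) (by simp [one_mem])
  generalize Nat.card (Subgroup.centralizer ({x} : Set G)) = n at *
  generalize Nat.card (Subgroup.centralizer ({t} : Set G)) = c at *
  generalize Nat.card (conjugatesOf t) = k at *
  generalize Nat.card (Subgroup.center G) = z at *
  generalize Finset.card _ = r at *
  generalize Nat.card G = N at *
  subst hclass
  have hmn : m < n := by
    by_contra! h
    rw [smul_eq_mul] at hsum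
    have h1 : k * c * n ≤ k * c * m := Nat.mul_le_mul_left _ h
    nlinarith
  have hk : 0 < k := Nat.pos_of_ne_zero (by rintro rfl; simp at hlt)
  have h1 : k ≤ z + c * m := by
    refine Nat.le_of_mul_le_mul_left ?_ hk
    nlinarith
  calc k * c ≤ (z + c * m) * c := Nat.mul_le_mul_right _ h1
    _ < (c + c * m) * c := by gcongr; omega
    _ = c ^ 2 * (m + 1) := by ring
    _ ≤ n ^ 2 * n := by gcongr; omega
    _ = n ^ 3 := by ring
end
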